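/- arXiv:2405.12960 — 2 statements merged into one kernel-verified Lean document; each statement's English description precedes it below -/
import Mathlib

section
/- Fix a probability measure ℚ on a measurable space (Ω, ℱ), where Ω is a Polish space with its Borel σ-algebra. Then for every c > 0, the set of probability measures {ℙ : D_{KL}(ℙ | ℚ) ≤ c} is compact with respect to the topology of weak convergence of probability measures. -/
open MeasureTheory Filter Topology
open scoped ENNReal NNReal Classical

/-- The Kullback–Leibler divergence `D_{KL}(P|Q) = ∫ log(dP/dQ) dP` when `P ≪ Q` and the
integral is defined, and `+∞` otherwise. -/
noncomputable def klDiv {Ω : Type*} [MeasurableSpace Ω] (P Q : Measure Ω) : ℝ≥0∞ :=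
  if P ≪ Q ∧ Integrable (fun ω => Real.log (P.rnDeriv Q ω).toReal) P
  then ENNReal.ofReal (∫ ω, Real.log (P.rnDeriv Q ω).toReal ∂P)
  else ⊤

lemma aux_young (p x : ℝ) (hp : 0 ≤ p) :
    p * x - (Real.exp x - 1) ≤ InformationTheory.klFun p := by
  rw [InformationTheory.klFun_apply]
  rcases hp.eq_or_lt with rfl | hp
  · have := Real.exp_pos x
    simp
    linarith
  · have h := Real.add_one_le_exp (x - Real.log p)
    rw [Real.exp_sub, Real.exp_log hp, le_div_iff₀ hp] at h
    nlinarith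

lemma aux_kl_eq {Ω : Type*} [MeasurableSpace Ω] (P Q : Measure Ω)
    [IsProbabilityMeasure P] [IsProbabilityMeasure Q] :
    klDiv P Q = InformationTheory.klDiv P Q := by
  by_cases h : P ≪ Q ∧ Integrable (fun ω => Real.log (P.rnDeriv Q ω).toReal) P
  · rw [klDiv, if_pos h, InformationTheory.klDiv_of_ac_of_integrable h.1 h.2]
    simp [llr]
  · rw [klDiv, if_neg h, eq_comm, InformationTheory.klDiv_eq_top_iff]
    intro h1 h2
    exact h ⟨h1, h2⟩

lemma aux_integrable_bdd {Ω : Type*} [MeasurableSpace Ω] (P : Measure Ω) [IsFiniteMeasure P]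
    {f : Ω → ℝ} (hf : Measurable f) {M : ℝ} (hM : ∀ x, |f x| ≤ M) : Integrable f P :=
  Integrable.of_bound hf.aestronglyMeasurable M (Eventually.of_forall hM)

lemma aux_integrable_exp {Ω : Type*} [MeasurableSpace Ω] (P : Measure Ω) [IsFiniteMeasure P]
    {f : Ω → ℝ} (hf : Measurable f) {M : ℝ} (hM : ∀ x, |f x| ≤ M) :
    Integrable (fun x => Real.exp (f x) - 1) P := by
  refine Integrable.sub (Integrable.of_bound (by fun_prop) (Real.exp M)
    (Eventually.of_forall fun x => ?_)) (integrable_const _)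
  rw [Real.norm_eq_abs, abs_of_pos (Real.exp_pos _)]
  exact Real.exp_le_exp.2 ((le_abs_self _).trans (hM x))

lemma aux_integrable_mul {Ω : Type*} [MeasurableSpace Ω] (P Q : Measure Ω)
    [IsProbabilityMeasure P] [IsProbabilityMeasure Q]
    {f : Ω → ℝ} (hf : Measurable f) {M : ℝ} (hM : ∀ x, |f x| ≤ M) :
    Integrable (fun x => (P.rnDeriv Q x).toReal * f x) Q :=
  Measure.integrable_toReal_rnDeriv.mul_bdd (c := M) hf.aestronglyMeasurable
    (Eventually.of_forall hM)

/-- The Donsker-Varadhan type upper bound. -/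
lemma aux_forward {Ω : Type*} [MeasurableSpace Ω] (P Q : Measure Ω)
    [IsProbabilityMeasure P] [IsProbabilityMeasure Q] (c : ℝ) (hc : 0 < c)
    (h : klDiv P Q ≤ ENNReal.ofReal c)
    {f : Ω → ℝ} (hf : Measurable f) {M : ℝ} (hM : ∀ x, |f x| ≤ M) :
    ∫ x, f x ∂P - ∫ x, (Real.exp (f x) - 1) ∂Q ≤ c := by
  rw [aux_kl_eq] at h
  have hne : InformationTheory.klDiv P Q ≠ ∞ := ne_top_of_le_ne_top (by simp) h
  obtain ⟨hac, hint⟩ := InformationTheory.klDiv_ne_top_iff.1 hne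
  have h2 := ENNReal.toReal_le_of_le_ofReal hc.le h
  rw [InformationTheory.toReal_klDiv_eq_integral_klFun hac] at h2
  refine le_trans ?_ h2
  rw [← integral_rnDeriv_smul hac]
  simp only [smul_eq_mul]
  rw [← integral_sub (aux_integrable_mul P Q hf hM) (aux_integrable_exp Q hf hM)]
  refine integral_mono ((aux_integrable_mul P Q hf hM).sub (aux_integrable_exp Q hf hM))
    ((InformationTheory.integrable_klFun_rnDeriv_iff hac).2 hint) fun x => ?_
  exact aux_young _ _ ENNReal.toReal_nonneg

/-- Extension of the variational bound from bounded continuous to bounded measurable functions. -/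
lemma aux_extend {Ω : Type*} [MetricSpace Ω] [MeasurableSpace Ω] [BorelSpace Ω] (P Q : Measure Ω)
    [IsProbabilityMeasure P] [IsProbabilityMeasure Q] (c : ℝ)
    (h : ∀ f : BoundedContinuousFunction Ω ℝ,
      ∫ x, f x ∂P - ∫ x, (Real.exp (f x) - 1) ∂Q ≤ c)
    {f : Ω → ℝ} (hf : Measurable f) {M : ℝ} (hM : ∀ x, |f x| ≤ M) :
    ∫ x, f x ∂P - ∫ x, (Real.exp (f x) - 1) ∂Q ≤ c := by
  have hM0 : 0 ≤ M := by
    obtain ⟨x⟩ : Nonempty Ω := nonempty_of_isProbabilityMeasure P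
    exact (abs_nonneg _).trans (hM x)
  have key : ∀ ε : ℝ, 0 < ε →
      ∫ x, f x ∂P - ∫ x, (Real.exp (f x) - 1) ∂Q ≤ c + (1 + Real.exp M) * ε := by
    intro ε hε
    obtain ⟨g, hg, hgi⟩ := (aux_integrable_bdd (P + Q) hf hM).exists_boundedContinuous_integral_sub_le
      hε
    set u : Ω → ℝ := fun x => max (-M) (min (g x) M) with hu
    have huc : Continuous u := by fun_prop
    have huM : ∀ x, |u x| ≤ M := fun x => by
      rw [abs_le]
      exact ⟨le_max_left _ _, max_le (by linarith) (min_le_right _ _)⟩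
    have h1 := h (BoundedContinuousFunction.ofNormedAddCommGroup u huc M huM)
    simp only [BoundedContinuousFunction.coe_ofNormedAddCommGroup] at h1
    have hd : ∀ x, |f x - u x| ≤ ‖f x - g x‖ := fun x => by
      have hfx := abs_le.1 (hM x)
      rw [Real.norm_eq_abs]
      simp only [hu]
      rcases le_total (g x) M with h3 | h3
      · rw [min_eq_left h3]
        rcases le_total (-M) (g x) with h4 | h4
        · rw [max_eq_right h4]
        · rw [max_eq_left h4, abs_of_nonneg (by linarith), abs_of_nonneg (by linarith)]
          linarith
      · rw [min_eq_right h3, max_eq_right (by linarith), abs_of_nonpos (by linarith),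
          abs_of_nonpos (by linarith)]
        linarith
    have hfg : Integrable (fun x => ‖f x - g x‖) (P + Q) :=
      ((aux_integrable_bdd (P + Q) hf hM).sub hgi).norm
    have hfgP := hfg.left_of_add_measure
    have hfgQ := hfg.right_of_add_measure
    rw [integral_add_measure hfgP hfgQ] at hg
    have e1 : 0 ≤ ∫ x, ‖f x - g x‖ ∂P := integral_nonneg fun x => norm_nonneg _
    have e2 : 0 ≤ ∫ x, ‖f x - g x‖ ∂Q := integral_nonneg fun x => norm_nonneg _
    have iu := aux_integrable_bdd P huc.measurable huM
    have iue := aux_integrable_exp Q huc.measurable huM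
    have i1 : ∫ x, f x ∂P ≤ ∫ x, u x ∂P + ∫ x, ‖f x - g x‖ ∂P := by
      rw [← integral_add iu hfgP]
      refine integral_mono (aux_integrable_bdd P hf hM) (iu.add hfgP) fun x => ?_
      have := (le_abs_self _).trans (hd x)
      simp only [Pi.add_apply]
      linarith
    have i2 : ∫ x, (Real.exp (u x) - 1) ∂Q ≤ ∫ x, (Real.exp (f x) - 1) ∂Q +
        ∫ x, Real.exp M * ‖f x - g x‖ ∂Q := by
      have ife := aux_integrable_exp Q hf hM
      rw [← integral_add ife (hfgQ.const_mul _)]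
      refine integral_mono iue (ife.add (hfgQ.const_mul _)) fun x => ?_
      have a1 := (neg_le_abs _).trans (hd x)
      have a2 := Real.add_one_le_exp (f x - u x)
      rw [Real.exp_sub, le_div_iff₀ (Real.exp_pos _)] at a2
      have a3 : Real.exp (u x) ≤ Real.exp M :=
        Real.exp_le_exp.2 ((le_abs_self _).trans (huM x))
      have a4 : Real.exp (u x) * (-(f x - u x)) ≤ Real.exp M * ‖f x - g x‖ :=
        (mul_le_mul_of_nonneg_left a1 (Real.exp_pos _).le).trans
          (mul_le_mul_of_nonneg_right a3 (norm_nonneg _))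
      simp only [Pi.add_apply]
      linarith
    rw [integral_const_mul] at i2
    have hE := Real.exp_pos M
    have i3 : ∫ x, ‖f x - g x‖ ∂P ≤ ε := by linarith
    have i4 : Real.exp M * ∫ x, ‖f x - g x‖ ∂Q ≤ Real.exp M * ε :=
      mul_le_mul_of_nonneg_left (by linarith) hE.le
    linarith
  have hE := Real.exp_pos M
  refine le_of_forall_pos_le_add fun δ hδ => ?_
  have := key (δ / (1 + Real.exp M)) (by positivity)
  rwa [mul_div_cancel₀ _ (by positivity)] at this

lemma aux_backward {Ω : Type*} [MeasurableSpace Ω] (P Q : Measure Ω)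
    [IsProbabilityMeasure P] [IsProbabilityMeasure Q] (c : ℝ)
    (h : ∀ f : Ω → ℝ, Measurable f → ∀ M : ℝ, (∀ x, |f x| ≤ M) →
      ∫ x, f x ∂P - ∫ x, (Real.exp (f x) - 1) ∂Q ≤ c) :
    klDiv P Q ≤ ENNReal.ofReal c := by
  have hac : P ≪ Q := by
    refine Measure.AbsolutelyContinuous.mk fun A hA hQA => ?_
    by_contra hPA
    have hpos : 0 < P.real A := by
      rw [measureReal_def]
      exact ENNReal.toReal_pos hPA (measure_ne_top _ _)
    obtain ⟨n, hn⟩ := exists_nat_gt (c / P.real A)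
    rw [div_lt_iff₀ hpos] at hn
    have h1 := h (A.indicator fun _ => (n : ℝ)) (measurable_const.indicator hA) n (fun x => by
      by_cases hx : x ∈ A <;> simp [hx])
    have h2 : ∫ x, (Real.exp (A.indicator (fun _ => (n : ℝ)) x) - 1) ∂Q = 0 := by
      refine integral_eq_zero_of_ae ?_
      have : ∀ᵐ x ∂Q, x ∉ A := measure_eq_zero_iff_ae_notMem.1 hQA
      filter_upwards [this] with x hx
      simp [hx]
    rw [h2, integral_indicator_const _ hA, smul_eq_mul] at h1
    linarith
  rw [aux_kl_eq, InformationTheory.klDiv_eq_lintegral_klFun_of_ac hac]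
  set p : Ω → ℝ := fun x => (P.rnDeriv Q x).toReal with hp
  have hpm : Measurable p := (Measure.measurable_rnDeriv P Q).ennreal_toReal
  have hp0 : ∀ x, 0 ≤ p x := fun x => ENNReal.toReal_nonneg
  let y : ℕ → Ω → ℝ := fun n x => max (Real.exp (-n)) (min (p x) (Real.exp n))
  have hy0 : ∀ n x, 0 < y n x := fun n x => lt_max_of_lt_left (Real.exp_pos _)
  have hym : ∀ n, Measurable (y n) := fun n =>
    measurable_const.max (hpm.min measurable_const)
  have hlm : ∀ n, Measurable (fun x => Real.log (y n x)) := fun n => (hym n).log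
  have hexp : ∀ n : ℕ, Real.exp (-n) ≤ 1 ∧ 1 ≤ Real.exp n := fun n =>
    ⟨Real.exp_le_one_iff.2 (by simp), Real.one_le_exp (by simp)⟩
  have hlb : ∀ (n : ℕ) x, |Real.log (y n x)| ≤ n := fun n x => by
    rw [abs_le, Real.le_log_iff_exp_le (hy0 n x), Real.log_le_iff_le_exp (hy0 n x)]
    exact ⟨le_max_left _ _, max_le ((hexp n).1.trans (hexp n).2) (min_le_right _ _)⟩
  let F : ℕ → Ω → ℝ := fun n x => p x * Real.log (y n x) - (Real.exp (Real.log (y n x)) - 1)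
  have hFm : ∀ n, Measurable (F n) := fun n =>
    (hpm.mul (hlm n)).sub ((Real.measurable_exp.comp (hlm n)).sub measurable_const)
  have hF0 : ∀ n x, 0 ≤ F n x := fun n x => by
    have hy := hy0 n x
    have a1 : y n x * Real.log (y n x) ≤ p x * Real.log (y n x) := by
      rcases le_total (Real.exp (-n)) (p x) with h1 | h1
      · rcases le_total (p x) (Real.exp n) with h2 | h2
        · have : y n x = p x := by simp only [y]; rw [min_eq_left h2, max_eq_right h1]
          rw [this]
        · have : y n x = Real.exp n := by
            simp only [y]; rw [min_eq_right h2, max_eq_right ((hexp n).1.trans (hexp n).2)]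
          rw [this, Real.log_exp]
          exact mul_le_mul_of_nonneg_right h2 (by simp)
      · have : y n x = Real.exp (-n) := by
          simp only [y]; rw [max_eq_left ((min_le_left _ _).trans h1)]
        rw [this, Real.log_exp]
        exact mul_le_mul_of_nonpos_right h1 (by simp)
    have a2 := InformationTheory.klFun_nonneg hy.le
    rw [InformationTheory.klFun_apply] at a2
    simp only [F]
    rw [Real.exp_log hy]
    linarith
  have hFlim : ∀ x, Tendsto (fun n => F n x) atTop (𝓝 (InformationTheory.klFun (p x))) := by
    intro x
    rcases (hp0 x).eq_or_lt with h0 | h0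
    · have e : ∀ n, F n x = 1 - Real.exp (-(n : ℝ)) := fun n => by
        have : y n x = Real.exp (-n) := by
          simp only [y]; rw [← h0, min_eq_left (Real.exp_pos _).le, max_eq_left (Real.exp_pos _).le]
        simp only [F]
        rw [this, ← h0, Real.log_exp]
        ring
      simp only [e, ← h0, InformationTheory.klFun_zero]
      have : Tendsto (fun n : ℕ => Real.exp (-(n : ℝ))) atTop (𝓝 0) :=
        Real.tendsto_exp_neg_atTop_nhds_zero.comp tendsto_natCast_atTop_atTop
      simpa using tendsto_const_nhds.sub this
    · refine tendsto_const_nhds.congr' ?_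
      obtain ⟨N, hN⟩ := exists_nat_ge |Real.log (p x)|
      filter_upwards [eventually_ge_atTop N] with n hn
      have hn' : |Real.log (p x)| ≤ n := hN.trans (by exact_mod_cast hn)
      rw [abs_le, Real.le_log_iff_exp_le h0, Real.log_le_iff_le_exp h0] at hn'
      have : y n x = p x := by simp only [y]; rw [min_eq_left hn'.2, max_eq_right hn'.1]
      simp only [F]
      rw [this, Real.exp_log h0, InformationTheory.klFun_apply]
      ring
  have hFi : ∀ n, ∫⁻ x, ENNReal.ofReal (F n x) ∂Q ≤ ENNReal.ofReal c := fun n => by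
    have j1 := aux_integrable_mul P Q (hlm n) (hlb n)
    have j2 := aux_integrable_exp Q (hlm n) (hlb n)
    have j3 : Integrable (F n) Q := j1.sub j2
    rw [← ofReal_integral_eq_lintegral_ofReal j3 (Eventually.of_forall (hF0 n))]
    refine ENNReal.ofReal_le_ofReal ?_
    have := h _ (hlm n) n (hlb n)
    rw [← integral_rnDeriv_smul hac] at this
    simp only [smul_eq_mul] at this
    rw [← integral_sub j1 j2] at this
    exact this
  calc ∫⁻ x, ENNReal.ofReal (InformationTheory.klFun (p x)) ∂Q
      = ∫⁻ x, liminf (fun n => ENNReal.ofReal (F n x)) atTop ∂Q := by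
        refine lintegral_congr fun x => ?_
        exact ((ENNReal.continuous_ofReal.tendsto _).comp (hFlim x)).liminf_eq.symm
    _ ≤ liminf (fun n => ∫⁻ x, ENNReal.ofReal (F n x) ∂Q) atTop :=
        lintegral_liminf_le fun n => (hFm n).ennreal_ofReal
    _ ≤ ENNReal.ofReal c := by
        refine (liminf_le_liminf (Eventually.of_forall hFi)).trans ?_
        simp

/-- sublevel sets of the Kullback–Leibler divergence with respect to a
fixed probability measure `Q` on a Polish space are compact in the topology of weak
convergence of probability measures. -/
theorem statement7 {Ω : Type*} [MetricSpace Ω] [CompleteSpace Ω]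
    [TopologicalSpace.SeparableSpace Ω] [MeasurableSpace Ω] [BorelSpace Ω]
    (Q : Measure Ω) [IsProbabilityMeasure Q] (c : ℝ) (hc : 0 < c) :
    IsCompact {P : ProbabilityMeasure Ω | klDiv (P : Measure Ω) Q ≤ ENNReal.ofReal c} := by
  have : SecondCountableTopology Ω := UniformSpace.secondCountable_of_separable Ω
  have hclosed : IsClosed {P : ProbabilityMeasure Ω | klDiv (P : Measure Ω) Q ≤ ENNReal.ofReal c} := by
    have heq : {P : ProbabilityMeasure Ω | klDiv (P : Measure Ω) Q ≤ ENNReal.ofReal c} =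
        ⋂ f : BoundedContinuousFunction Ω ℝ, {P : ProbabilityMeasure Ω |
          ∫ x, f x ∂(P : Measure Ω) - ∫ x, (Real.exp (f x) - 1) ∂Q ≤ c} := by
      ext P
      simp only [Set.mem_ofPred_eq, Set.mem_iInter]
      constructor
      · intro h f
        exact aux_forward _ Q c hc h f.continuous.measurable (M := ‖f‖) f.norm_coe_le_norm
      · intro h
        exact aux_backward _ Q c fun f hf M hM => aux_extend _ Q c h hf hM
    rw [heq]
    refine isClosed_iInter fun f => isClosed_le (Continuous.sub ?_ continuous_const)
      continuous_const
    exact continuous_iff_continuousAt.2 fun P =>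
      ProbabilityMeasure.tendsto_iff_forall_integral_tendsto.1 tendsto_id f
  have htight : IsTightMeasureSet {((P : ProbabilityMeasure Ω) : Measure Ω) |
      P ∈ {P : ProbabilityMeasure Ω | klDiv (P : Measure Ω) Q ≤ ENNReal.ofReal c}} := by
    rw [isTightMeasureSet_iff_exists_isCompact_measure_compl_le]
    intro ε hε
    obtain ⟨δ, hδ0, hδ⟩ : ∃ δ : ℝ, 0 < δ ∧ ENNReal.ofReal δ ≤ ε := by
      rcases eq_or_ne ε ∞ with rfl | hne
      · exact ⟨1, one_pos, le_top⟩
      · exact ⟨ε.toReal, ENNReal.toReal_pos hε.ne' hne, (ENNReal.ofReal_toReal hne).le⟩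
    set n : ℝ := (c + 1) / δ with hn
    have hn0 : 0 < n := by positivity
    have hE := Real.exp_pos n
    obtain ⟨K, hK, hQK⟩ := isTightMeasureSet_iff_exists_isCompact_measure_compl_le.1
      (isTightMeasureSet_singleton (μ := Q)) (ENNReal.ofReal (1 / Real.exp n)) (by simp; positivity)
    refine ⟨K, hK, ?_⟩
    rintro _ ⟨P, hP, rfl⟩
    have hA : MeasurableSet Kᶜ := hK.measurableSet.compl
    have hQ := ENNReal.toReal_le_of_le_ofReal (by positivity) (hQK Q rfl)
    have h1 := aux_forward _ Q c hc hP (f := Kᶜ.indicator fun _ => n)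
      (measurable_const.indicator hA) (M := n) (fun x => by
        by_cases hx : x ∈ K <;> simp [hx, hn0.le, abs_of_pos hn0])
    have h2 : ∫ x, (Real.exp (Kᶜ.indicator (fun _ => n) x) - 1) ∂Q =
        Q.real Kᶜ * (Real.exp n - 1) := by
      rw [← smul_eq_mul, ← integral_indicator_const _ hA]
      refine integral_congr_ae (Eventually.of_forall fun x => ?_)
      by_cases hx : x ∈ K <;> simp [hx]
    rw [h2, integral_indicator_const _ hA, smul_eq_mul] at h1
    rw [← measureReal_def, le_div_iff₀ hE] at hQ
    have hQ0 : 0 ≤ Q.real Kᶜ := measureReal_nonneg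
    have h3 : (P : Measure Ω).real Kᶜ * n ≤ c + 1 := by linarith
    have h4 : (P : Measure Ω).real Kᶜ ≤ δ := by
      have : c + 1 = δ * n := by rw [hn]; field_simp
      rw [this] at h3
      exact le_of_mul_le_mul_right h3 hn0
    refine le_trans ?_ hδ
    rw [← ENNReal.ofReal_toReal (measure_ne_top (P : Measure Ω) Kᶜ)]
    exact ENNReal.ofReal_le_ofReal h4
  have := isCompact_closure_of_isTightMeasureSet htight
  rwa [hclosed.closure_eq] at this
end

section
/- Let Σ_t^N = (1/N)Σ_{j=1}^N δ_{X_t^{(N),j}} and Σ̃_t^N = (1/N)Σ_{j=1}^N δ_{X_t^{(∞),j}} be empirical measures of particle systems defined on a common probability space (Ω̃, ℙ̃), where for each j, X^{(N),j} → X^{(∞),j} almost surely as N → ∞ (in C⁰([0,T],ℝⁿ)), the particles are exchangeable, sup_N E[|X_t^{(N),1}|²] < ∞, and the variables X^{(∞),j} are conditionally i.i.d. with (random) directing measure ν such that Σ̃_t^N ⇀ ν_t almost surely by de Finetti's theorem. Then for every fixed t ∈ [0,T] and every 1 ≤ p < 2, E_{ℙ̃}[W_p^p(Σ_t^N, ν_t)]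 → 0 as N → ∞. -/
open MeasureTheory Filter Topology Set
open scoped ENNReal NNReal

/-- The `p`-th power of the `p`-Wasserstein distance. -/
noncomputable def WppE {E : Type*} [MeasurableSpace E] [PseudoMetricSpace E]
    (p : ℝ) (μ ν : Measure E) : ℝ≥0∞ :=
  ⨅ (π : Measure (E × E)) (_ : π.map Prod.fst = μ) (_ : π.map Prod.snd = ν),
    ∫⁻ z, ENNReal.ofReal (dist z.1 z.2 ^ p) ∂π

/-- The empirical measure `(1/N) Σ_{j<N} δ_{x_j}`. -/
noncomputable def empirical {E : Type*} [MeasurableSpace E] (N : ℕ) (x : ℕ → E) :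
    Measure E :=
  (N : ℝ≥0∞)⁻¹ • ∑ j ∈ Finset.range N, Measure.dirac (x j)


section Coupling

variable {E : Type*} [MeasurableSpace E] [PseudoMetricSpace E]

lemma WppE_le (p : ℝ) (μ ν : Measure E) (π : Measure (E × E)) (h1 : π.map Prod.fst = μ)
    (h2 : π.map Prod.snd = ν) : WppE p μ ν ≤ ∫⁻ z, ENNReal.ofReal (dist z.1 z.2 ^ p) ∂π :=
  iInf_le_of_le π (iInf_le_of_le h1 (iInf_le _ h2))

lemma WppE_zero (p : ℝ) : WppE p (0 : Measure E) 0 = 0 := by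
  have := WppE_le p (0 : Measure E) 0 0 (by simp) (by simp)
  simpa using this

lemma WppE_add (p : ℝ) (μ₁ μ₂ ν₁ ν₂ : Measure E) :
    WppE p (μ₁ + μ₂) (ν₁ + ν₂) ≤ WppE p μ₁ ν₁ + WppE p μ₂ ν₂ := by
  conv_rhs => unfold WppE
  simp only [ENNReal.iInf_add, ENNReal.add_iInf]
  refine le_iInf fun π₁ => le_iInf fun h1 => le_iInf fun h2 => le_iInf fun π₂ =>
    le_iInf fun h3 => le_iInf fun h4 => ?_
  rw [← lintegral_add_measure]
  apply WppE_le
  · rw [Measure.map_add _ _ measurable_fst, ← h1]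
    rw [← h3]
  · rw [Measure.map_add _ _ measurable_snd, ← h2]
    rw [← h4]

lemma WppE_sum (p : ℝ) {ι : Type*} (s : Finset ι) (μ ν : ι → Measure E) :
    WppE p (∑ i ∈ s, μ i) (∑ i ∈ s, ν i) ≤ ∑ i ∈ s, WppE p (μ i) (ν i) := by
  classical
  induction s using Finset.induction_on with
  | empty => simp [WppE_zero]
  | insert a s ha ih =>
    rw [Finset.sum_insert ha, Finset.sum_insert ha, Finset.sum_insert ha]
    exact (WppE_add _ _ _ _ _).trans (by gcongr)

variable [BorelSpace E] [SecondCountableTopology E]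

lemma WppE_prod (p : ℝ) (μ ν : Measure E) [IsFiniteMeasure μ] [IsFiniteMeasure ν]
    (hmass : μ univ = ν univ) (h : E → ℝ≥0∞) (hm : Measurable h)
    (hle : ∀ᵐ x ∂μ, ∀ᵐ y ∂ν, ENNReal.ofReal (dist x y ^ p) ≤ h x + h y) :
    WppE p μ ν ≤ ∫⁻ x, h x ∂μ + ∫⁻ x, h x ∂ν := by
  by_cases h0 : μ univ = 0
  · have h1 : ν univ = 0 := hmass ▸ h0
    rw [Measure.measure_univ_eq_zero] at h0 h1
    subst h0 h1
    simp [WppE_zero]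
  have hfin : μ univ ≠ ⊤ := measure_ne_top _ _
  have hone : (μ univ)⁻¹ * μ univ = 1 := ENNReal.inv_mul_cancel h0 hfin
  have hone' : μ univ * (μ univ)⁻¹ = 1 := ENNReal.mul_inv_cancel h0 hfin
  refine (WppE_le p μ ν ((μ univ)⁻¹ • μ.prod ν) ?_ ?_).trans ?_
  · rw [Measure.map_smul, Measure.map_fst_prod, ← hmass, smul_smul, hone, one_smul]
  · rw [Measure.map_smul, Measure.map_snd_prod, smul_smul, hone, one_smul]
  · rw [lintegral_smul_measure, smul_eq_mul]
    have hmeas : Measurable fun z : E × E => ENNReal.ofReal (dist z.1 z.2 ^ p) := by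
      fun_prop
    rw [lintegral_prod _ hmeas.aemeasurable]
    calc (μ univ)⁻¹ * ∫⁻ x, ∫⁻ y, ENNReal.ofReal (dist x y ^ p) ∂ν ∂μ
        ≤ (μ univ)⁻¹ * ∫⁻ x, ∫⁻ y, (h x + h y) ∂ν ∂μ := by
          gcongr 1
          apply lintegral_mono_ae
          filter_upwards [hle] with x hx
          exact lintegral_mono_ae hx
      _ = (μ univ)⁻¹ * ∫⁻ x, (h x * μ univ + ∫⁻ y, h y ∂ν) ∂μ := by
          congr 2
          ext x
          rw [lintegral_add_left measurable_const, lintegral_const, hmass]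
      _ = ∫⁻ x, h x ∂μ + ∫⁻ x, h x ∂ν := by
          rw [lintegral_add_left (hm.mul_const _), lintegral_const, lintegral_mul_const _ hm,
            ← add_mul, mul_comm _ (μ univ), ← mul_assoc, hone, one_mul]

lemma WppE_coupling (p : ℝ) (μ ν : Measure E) [IsProbabilityMeasure μ] [IsProbabilityMeasure ν]
    {ι : Type*} [Fintype ι] (φ : ι → E → ℝ≥0∞) (hφ : ∀ i, Measurable (φ i))
    (hφ1 : ∀ x, ∑ i, φ i x ≤ 1) (q : E → ℝ≥0∞) (hq : Measurable q)
    (A B κ D : ℝ≥0∞)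
    (hnear : ∀ i x y, φ i x ≠ 0 → φ i y ≠ 0 → ENNReal.ofReal (dist x y ^ p) ≤ D)
    (hcover : ∀ x, 1 ≤ ∑ i, φ i x + κ * q x)
    (hfar : ∀ x y, ENNReal.ofReal (dist x y ^ p) ≤ (A + B * q x) + (A + B * q y)) :
    WppE p μ ν ≤ 2 * D + 2 * A * (∑ i, (∫⁻ x, φ i x ∂μ - ∫⁻ x, φ i x ∂ν) + κ * ∫⁻ x, q x ∂μ)
      + B * (∫⁻ x, q x ∂μ + ∫⁻ x, q x ∂ν) := by
  set a : ι → ℝ≥0∞ := fun i => ∫⁻ x, φ i x ∂μ with ha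
  set b : ι → ℝ≥0∞ := fun i => ∫⁻ x, φ i x ∂ν with hb
  have sumle (m : Measure E) [IsProbabilityMeasure m] : ∑ i, ∫⁻ x, φ i x ∂m ≤ 1 := by
    rw [← lintegral_finsetSum _ (fun i _ => hφ i)]
    calc _ ≤ ∫⁻ x, 1 ∂m := lintegral_mono hφ1
      _ = 1 := by simp
  have hale : ∑ i, a i ≤ 1 := sumle μ
  have hble : ∑ i, b i ≤ 1 := sumle ν
  have finle (f : ι → ℝ≥0∞) (hf : ∑ i, f i ≤ 1) (i : ι) : f i ≠ ⊤ :=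
    ne_top_of_le_ne_top ENNReal.one_ne_top
      ((Finset.single_le_sum (fun _ _ => zero_le) (Finset.mem_univ i)).trans hf)
  set c : ι → ℝ≥0∞ := fun i => min (a i) (b i) with hc
  have hcle : ∑ i, c i ≤ 1 := (Finset.sum_le_sum fun i _ => min_le_left _ _).trans hale
  -- generic facts about one marginal
  have key (m : Measure E) [IsProbabilityMeasure m] (hcm : ∀ i, c i ≤ ∫⁻ x, φ i x ∂m) :
      ∃ f : ι → E → ℝ≥0∞, (∀ i, Measurable (f i)) ∧ (∀ x, ∑ i, f i x ≤ 1) ∧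
        (∀ i, ∫⁻ x, f i x ∂m = c i) ∧ (∀ i x, f i x ≠ 0 → φ i x ≠ 0) ∧
        m = ∑ i, m.withDensity (f i) + m.withDensity (fun x => 1 - ∑ i, f i x) ∧
        ∫⁻ x, (1 - ∑ i, f i x) ∂m = 1 - ∑ i, c i := by
    have hfin := finle _ (sumle m)
    have fm : ∀ i, Measurable (fun x => c i / (∫⁻ x, φ i x ∂m) * φ i x) :=
      fun i => (hφ i).const_mul _
    have f1 : ∀ x, ∑ i, c i / (∫⁻ x, φ i x ∂m) * φ i x ≤ 1 := by
      intro x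
      refine (Finset.sum_le_sum fun i _ => ?_).trans (hφ1 x)
      exact mul_le_of_le_one_left' (ENNReal.div_le_of_le_mul (by simpa using hcm i))
    have fc : ∀ i, ∫⁻ x, c i / (∫⁻ x, φ i x ∂m) * φ i x ∂m = c i := by
      intro i
      rw [lintegral_const_mul _ (hφ i)]
      by_cases h0 : ∫⁻ x, φ i x ∂m = 0
      · have := hcm i
        rw [h0] at this ⊢
        simp at this
        simp [this]
      · exact ENNReal.div_mul_cancel h0 (hfin i)
    refine ⟨fun i x => c i / (∫⁻ x, φ i x ∂m) * φ i x, fm, f1, fc, ?_, ?_, ?_⟩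
    · intro i x h
      exact right_ne_zero_of_mul h
    · ext s hs
      rw [Measure.add_apply, Measure.finsetSum_apply, withDensity_apply _ hs]
      simp_rw [withDensity_apply _ hs]
      rw [← lintegral_finsetSum _ (fun i _ => fm i),
        ← lintegral_add_left (Finset.measurable_fun_sum _ fun i _ => fm i)]
      simp_rw [add_tsub_cancel_of_le (f1 _)]
      simp
    · rw [lintegral_sub (Finset.measurable_fun_sum _ fun i _ => fm i) _ (ae_of_all _ f1),
        lintegral_finsetSum _ (fun i _ => fm i)]
      · simp_rw [fc]; simp
      · rw [lintegral_finsetSum _ (fun i _ => fm i)]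
        simp_rw [fc]
        exact ne_top_of_le_ne_top ENNReal.one_ne_top hcle
  obtain ⟨f, fm, f1, fc, fφ, fdec, fres⟩ := key μ (fun i => min_le_left _ _)
  obtain ⟨g, gm, g1, gc, gφ, gdec, gres⟩ := key ν (fun i => min_le_right _ _)
  have hres : 1 - ∑ i, c i ≤ ∑ i, (a i - b i) + κ * ∫⁻ x, q x ∂μ := by
    have h1 : 1 ≤ ∑ i, a i + κ * ∫⁻ x, q x ∂μ := by
      rw [← lintegral_finsetSum _ (fun i _ => hφ i), ← lintegral_const_mul _ hq,
        ← lintegral_add_right _ (hq.const_mul κ)]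
      calc 1 = ∫⁻ x, 1 ∂μ := by simp
        _ ≤ _ := lintegral_mono hcover
    have h2 : ∑ i, a i ≤ ∑ i, c i + ∑ i, (a i - b i) := by
      rw [← Finset.sum_add_distrib]
      refine Finset.sum_le_sum fun i _ => ?_
      rcases le_total (a i) (b i) with h | h
      · simp [hc, h]
      · simp [hc, h, add_tsub_cancel_of_le]
    rw [tsub_le_iff_left]
    calc 1 ≤ _ := h1
      _ ≤ _ := by rw [← add_assoc]; gcongr
  have wd (m : Measure E) (u : E → ℝ≥0∞) (r : E → ℝ≥0∞) (hu : Measurable u) (hr : Measurable r) :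
      ∫⁻ x, r x ∂(m.withDensity u) = ∫⁻ x, u x * r x ∂m := by
    rw [lintegral_withDensity_eq_lintegral_mul _ hu hr]; rfl
  have nearb (i : ι) : WppE p (μ.withDensity (f i)) (ν.withDensity (g i)) ≤ 2 * D * c i := by
    have : IsFiniteMeasure (μ.withDensity (f i)) :=
      isFiniteMeasure_withDensity (by rw [fc]; exact finle _ hcle i)
    have : IsFiniteMeasure (ν.withDensity (g i)) :=
      isFiniteMeasure_withDensity (by rw [gc]; exact finle _ hcle i)
    refine (WppE_prod p _ _ ?_ (fun _ => D) measurable_const ?_).trans ?_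
    · simp [fc, gc]
    · rw [ae_withDensity_iff (fm i)]
      refine ae_of_all _ fun x hx => ?_
      rw [ae_withDensity_iff (gm i)]
      refine ae_of_all _ fun y hy => ?_
      exact (hnear i x y (fφ _ _ hx) (gφ _ _ hy)).trans le_self_add
    · simp [fc, gc]
      apply le_of_eq; ring
  have farb : WppE p (μ.withDensity (fun x => 1 - ∑ i, f i x))
      (ν.withDensity (fun x => 1 - ∑ i, g i x)) ≤
      2 * A * (∑ i, (a i - b i) + κ * ∫⁻ x, q x ∂μ) + B * (∫⁻ x, q x ∂μ + ∫⁻ x, q x ∂ν) := by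
    have : IsFiniteMeasure (μ.withDensity (fun x => 1 - ∑ i, f i x)) :=
      isFiniteMeasure_withDensity (by rw [fres]; simp)
    have : IsFiniteMeasure (ν.withDensity (fun x => 1 - ∑ i, g i x)) :=
      isFiniteMeasure_withDensity (by rw [gres]; simp)
    refine (WppE_prod p _ _ ?_ (fun x => A + B * q x) (by fun_prop) ?_).trans ?_
    · simp [fres, gres]
    · exact ae_of_all _ fun x => ae_of_all _ fun y => hfar x y
    · have est (m : Measure E) (w : E → ℝ≥0∞) (hw : Measurable w) (hw1 : ∀ x, w x ≤ 1)  :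
          ∫⁻ x, (A + B * q x) ∂(m.withDensity w) ≤ A * ∫⁻ x, w x ∂m + B * ∫⁻ x, q x ∂m := by
        rw [wd _ _ _ hw (by fun_prop), ← lintegral_const_mul _ hw, ← lintegral_const_mul _ hq,
          ← lintegral_add_left (by fun_prop)]
        refine lintegral_mono fun x => ?_
        rw [mul_add, mul_comm (w x) A]
        refine add_le_add le_rfl ?_
        calc w x * (B * q x) ≤ 1 * (B * q x) := by gcongr; exact hw1 x
          _ = B * q x := one_mul _
      refine (add_le_add (est μ _ (by fun_prop) (fun x => tsub_le_self))
        (est ν _ (by fun_prop) (fun x => tsub_le_self))).trans ?_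
      rw [fres, gres]
      calc _ = 2 * A * (1 - ∑ i, c i) + B * (∫⁻ x, q x ∂μ + ∫⁻ x, q x ∂ν) := by ring
        _ ≤ _ := by gcongr
  calc WppE p μ ν ≤ ∑ i, WppE p (μ.withDensity (f i)) (ν.withDensity (g i)) +
        WppE p (μ.withDensity (fun x => 1 - ∑ i, f i x))
          (ν.withDensity (fun x => 1 - ∑ i, g i x)) := by
        conv_lhs => rw [fdec, gdec]
        exact (WppE_add _ _ _ _ _).trans (by gcongr; exact WppE_sum _ _ _ _)
    _ ≤ 2 * D * ∑ i, c i + _ := by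
        refine add_le_add ?_ farb
        rw [Finset.mul_sum]
        exact Finset.sum_le_sum fun i _ => nearb i
    _ ≤ 2 * D * 1 + _ := by gcongr
    _ = _ := by rw [mul_one, ← add_assoc]

end Coupling

lemma exists_pou {n : ℕ} (ε R : ℝ) (hε : 0 < ε) :
    ∃ (ι : Type) (_ : Fintype ι) (φ : ι → EuclideanSpace ℝ (Fin n) → ℝ),
      (∀ i, Continuous (φ i)) ∧ (∀ i x, 0 ≤ φ i x) ∧ (∀ x, ∑ i, φ i x ≤ 1) ∧
      (∀ x, ‖x‖ ≤ R → ∑ i, φ i x = 1) ∧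
      (∀ i x y, φ i x ≠ 0 → φ i y ≠ 0 → dist x y ≤ 2 * ε) := by
  have hK : IsCompact (Metric.closedBall (0 : EuclideanSpace ℝ (Fin n)) R) :=
    isCompact_closedBall _ _
  obtain ⟨s, -, hsf, hs⟩ := hK.finite_cover_balls hε
  obtain ⟨m, c, hc⟩ : ∃ (m : ℕ) (c : Fin m → EuclideanSpace ℝ (Fin n)), range c = s := by
    obtain ⟨m, c, hc⟩ := hsf.fin_param
    exact ⟨m, c, hc.2⟩
  obtain ⟨f, hf⟩ := PartitionOfUnity.exists_isSubordinate_of_locallyFinite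
    (Metric.isClosed_closedBall) (fun i : Fin m => Metric.ball (c i) ε)
    (fun i => Metric.isOpen_ball) (locallyFinite_of_finite _) (s := Metric.closedBall 0 R) (by
      intro x hx
      have := hs hx
      simp only [mem_iUnion] at this ⊢
      obtain ⟨y, hy, hxy⟩ := this
      rw [← hc] at hy
      obtain ⟨i, rfl⟩ := hy
      exact ⟨i, hxy⟩)
  refine ⟨Fin m, inferInstance, fun i x => f i x, fun i => (f i).continuous, fun i x => f.nonneg i x,
    fun x => ?_, fun x hx => ?_, fun i x y hx hy => ?_⟩
  · have := f.sum_le_one x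
    rwa [finsum_eq_sum_of_fintype] at this
  · have := f.sum_eq_one (x := x) (by simpa using hx)
    rwa [finsum_eq_sum_of_fintype] at this
  · have h1 : x ∈ Metric.ball (c i) ε := hf i (subset_tsupport _ hx)
    have h2 : y ∈ Metric.ball (c i) ε := hf i (subset_tsupport _ hy)
    rw [Metric.mem_ball] at h1 h2
    linarith [dist_triangle_right x y (c i)]

lemma pow_bound (r R p : ℝ) (hr : 0 ≤ r) (hR : 0 < R) (hp : 1 ≤ p) (hp2 : p < 2) :
    r ^ p ≤ R ^ p + R ^ (p - 2) * r ^ 2 := by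
  rcases le_total r R with h | h
  · have := Real.rpow_le_rpow hr h (by linarith : 0 ≤ p)
    have : 0 ≤ R ^ (p - 2) * r ^ 2 := by positivity
    linarith
  · have hr0 : 0 < r := hR.trans_le h
    have h1 : r ^ p = r ^ (p - 2) * r ^ 2 := by
      rw [← Real.rpow_natCast r 2, ← Real.rpow_add hr0]; norm_num
    have h2 : r ^ (p - 2) ≤ R ^ (p - 2) := Real.rpow_le_rpow_of_nonpos hR h (by linarith)
    have : 0 ≤ R ^ p := by positivity
    rw [h1]
    nlinarith [sq_nonneg r]

lemma dist_bound {E : Type*} [NormedAddCommGroup E] (x y : E) (R p : ℝ) (hR : 0 < R) (hp : 1 ≤ p)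
    (hp2 : p < 2) :
    dist x y ^ p ≤ (4 * R ^ p + 4 * R ^ (p - 2) * ‖x‖ ^ 2)
      + (4 * R ^ p + 4 * R ^ (p - 2) * ‖y‖ ^ 2) := by
  have key : ∀ a b : ℝ, 0 ≤ a → a ≤ b → ∀ d, 0 ≤ d → d ≤ a + b → 
      d ^ p ≤ 4 * R ^ p + 4 * R ^ (p - 2) * b ^ 2 := by
    intro a b ha hab d hd hdab
    have h1 : d ^ p ≤ (2 * b) ^ p := Real.rpow_le_rpow hd (by linarith) (by linarith)
    rw [Real.mul_rpow (by norm_num) (by linarith)] at h1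
    have h2 : (2 : ℝ) ^ p ≤ 4 := by
      calc (2 : ℝ) ^ p ≤ 2 ^ (2 : ℝ) := Real.rpow_le_rpow_of_exponent_le (by norm_num) hp2.le
        _ = 4 := by norm_num
    have h3 := pow_bound b R p (by linarith) hR hp hp2
    have h4 : 0 ≤ b ^ p := Real.rpow_nonneg (by linarith) _
    nlinarith
  have hd : dist x y ≤ ‖x‖ + ‖y‖ := by rw [dist_eq_norm]; exact norm_sub_le _ _
  have hx : 0 ≤ 4 * R ^ p + 4 * R ^ (p - 2) * ‖x‖ ^ 2 := by positivity
  have hy : 0 ≤ 4 * R ^ p + 4 * R ^ (p - 2) * ‖y‖ ^ 2 := by positivity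
  rcases le_total ‖x‖ ‖y‖ with h | h
  · have := key _ _ (norm_nonneg x) h _ dist_nonneg hd
    linarith
  · have := key _ _ (norm_nonneg y) h _ dist_nonneg (by linarith : dist x y ≤ _)
    linarith

/-- Deterministic bound on the Wasserstein cost by finitely many test functions and moments. -/
lemma WppE_bound {n : ℕ} (p ε R : ℝ) (hp : 1 ≤ p) (hp2 : p < 2) (hε : 0 < ε) (hR : 0 < R) :
    ∃ (ι : Type) (_ : Fintype ι) (φ : ι → EuclideanSpace ℝ (Fin n) → ℝ),
      (∀ i, Continuous (φ i)) ∧ (∀ i x, |φ i x| ≤ 1) ∧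
      ∀ (μ ν : Measure (EuclideanSpace ℝ (Fin n))), IsProbabilityMeasure μ →
        IsProbabilityMeasure ν →
        WppE p μ ν ≤ 2 * ENNReal.ofReal ((2 * ε) ^ p) + 2 * ENNReal.ofReal (4 * R ^ p) *
          ∑ i, ENNReal.ofReal |∫ x, φ i x ∂μ - ∫ x, φ i x ∂ν| +
          ENNReal.ofReal (12 * R ^ (p - 2)) *
            (∫⁻ x, ‖x‖ₑ ^ 2 ∂μ + ∫⁻ x, ‖x‖ₑ ^ 2 ∂ν) := by
  obtain ⟨ι, _, φ, hc, h0, h1, hs, hn⟩ := exists_pou (n := n) ε R hε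
  have hle : ∀ i x, φ i x ≤ 1 := fun i x =>
    (Finset.single_le_sum (fun i _ => h0 i x) (Finset.mem_univ i)).trans (h1 x)
  refine ⟨ι, inferInstance, φ, hc, fun i x => by rw [abs_of_nonneg (h0 i x)]; exact hle i x, ?_⟩
  intro μ ν hμ hν
  have hq : ∀ x : EuclideanSpace ℝ (Fin n), ‖x‖ₑ ^ 2 = ENNReal.ofReal (‖x‖ ^ 2) := fun x => by
    rw [← ofReal_norm, ENNReal.ofReal_pow (norm_nonneg _)]
  have hsum : ∀ x, ∑ i, ENNReal.ofReal (φ i x) = ENNReal.ofReal (∑ i, φ i x) := fun x =>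
    (ENNReal.ofReal_sum_of_nonneg fun i _ => h0 i x).symm
  have hb := WppE_coupling p μ ν (fun i x => ENNReal.ofReal (φ i x))
    (fun i => (hc i).measurable.ennreal_ofReal)
    (fun x => by rw [hsum]; exact ENNReal.ofReal_le_one.2 (h1 x))
    (fun x => ‖x‖ₑ ^ 2) (by fun_prop) (ENNReal.ofReal (4 * R ^ p))
    (ENNReal.ofReal (4 * R ^ (p - 2))) (ENNReal.ofReal (R⁻¹ ^ 2)) (ENNReal.ofReal ((2 * ε) ^ p))
    (by
      intro i x y hx hy
      refine ENNReal.ofReal_le_ofReal (Real.rpow_le_rpow dist_nonneg ?_ (by linarith))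
      exact hn i x y (fun h => hx (by simp [h])) (fun h => hy (by simp [h])))
    (by
      intro x
      rw [hsum, hq, ← ENNReal.ofReal_mul (by positivity)]
      rcases le_total ‖x‖ R with h | h
      · rw [hs x h]; simp
      · refine le_trans ?_ le_add_self
        rw [ENNReal.one_le_ofReal, ← mul_pow]
        apply one_le_pow₀
        rw [inv_mul_eq_div, one_le_div hR]
        exact h)
    (by
      intro x y
      rw [hq, hq, ← ENNReal.ofReal_mul (by positivity), ← ENNReal.ofReal_mul (by positivity),
        ← ENNReal.ofReal_add (by positivity) (by positivity),
        ← ENNReal.ofReal_add (by positivity) (by positivity),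
        ← ENNReal.ofReal_add (by positivity) (by positivity)]
      exact ENNReal.ofReal_le_ofReal (dist_bound x y R p hR hp hp2))
  refine hb.trans ?_
  have hint : ∀ (m : Measure (EuclideanSpace ℝ (Fin n))) [IsProbabilityMeasure m] (i : ι),
      ∫⁻ x, ENNReal.ofReal (φ i x) ∂m = ENNReal.ofReal (∫ x, φ i x ∂m) := by
    intro m _ i
    rw [ofReal_integral_eq_lintegral_ofReal _ (ae_of_all _ (h0 i))]
    refine Integrable.of_bound (hc i).aestronglyMeasurable 1 (ae_of_all _ fun x => ?_)
    rw [Real.norm_of_nonneg (h0 i x)]; exact hle i x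
  have hdiff : ∀ i, ∫⁻ x, ENNReal.ofReal (φ i x) ∂μ - ∫⁻ x, ENNReal.ofReal (φ i x) ∂ν ≤
      ENNReal.ofReal |∫ x, φ i x ∂μ - ∫ x, φ i x ∂ν| := by
    intro i
    rw [hint, hint, ← ENNReal.ofReal_sub _ (integral_nonneg (h0 i))]
    exact ENNReal.ofReal_le_ofReal (le_abs_self _)
  have hA : 2 * ENNReal.ofReal (4 * R ^ p) * ENNReal.ofReal (R⁻¹ ^ 2) =
      ENNReal.ofReal (8 * R ^ (p - 2)) := by
    rw [← ENNReal.ofReal_ofNat 2, ← ENNReal.ofReal_mul (by positivity),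
      ← ENNReal.ofReal_mul (by positivity)]
    congr 1
    rw [Real.rpow_sub hR]
    norm_num
    ring
  have hB : ENNReal.ofReal (12 * R ^ (p - 2)) =
      ENNReal.ofReal (8 * R ^ (p - 2)) + ENNReal.ofReal (4 * R ^ (p - 2)) := by
    rw [← ENNReal.ofReal_add (by positivity) (by positivity)]
    congr 1; ring
  rw [hB]
  set M := ∫⁻ x, ‖x‖ₑ ^ 2 ∂μ
  set M' := ∫⁻ x, ‖x‖ₑ ^ 2 ∂ν
  rw [mul_add (2 * _), ← mul_assoc (2 * _), hA, add_mul, add_assoc, add_assoc, add_assoc]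
  gcongr
  · exact hdiff _
  · exact le_self_add

lemma exists_perm_pair {N : ℕ} (i j k l : Fin N) (hij : i ≠ j) (hkl : k ≠ l) :
    ∃ σ : Equiv.Perm (Fin N), σ k = i ∧ σ l = j := by
  refine ⟨Equiv.swap (Equiv.swap k i l) j * Equiv.swap k i, ?_, ?_⟩
  · rw [Equiv.Perm.mul_apply, Equiv.swap_apply_left]
    refine Equiv.swap_apply_of_ne_of_ne ?_ hij
    intro h
    have : Equiv.swap k i k = Equiv.swap k i l := by rw [Equiv.swap_apply_left]; exact h
    exact hkl ((Equiv.swap k i).injective this)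
  · rw [Equiv.Perm.mul_apply, Equiv.swap_apply_left]

section Exch

variable {Ω E : Type*} [MeasurableSpace Ω] [MeasurableSpace E] {ℙ : Measure Ω}
  [IsProbabilityMeasure ℙ]

lemma exch_integral {N : ℕ} (Y : ℕ → Ω → E) (hY : ∀ j, Measurable (Y j))
    (hex : ∀ σ : Equiv.Perm (Fin N), ℙ.map (fun ω => fun j : Fin N => Y (σ j) ω)
        = ℙ.map (fun ω => fun j : Fin N => Y j ω))
    (f : E → ℝ) (hf : Measurable f) (σ : Equiv.Perm (Fin N)) (i j : Fin N) :
    ∫ ω, f (Y (σ i) ω) * f (Y (σ j) ω) ∂ℙ = ∫ ω, f (Y i ω) * f (Y j ω) ∂ℙ := by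
  have hF : StronglyMeasurable (fun z : Fin N → E => f (z i) * f (z j)) := by
    apply Measurable.stronglyMeasurable
    fun_prop
  have h1 := integral_map (μ := ℙ) (φ := fun ω => fun j : Fin N => Y (σ j) ω)
    (measurable_pi_lambda _ fun j => hY _).aemeasurable
    (hF.aestronglyMeasurable)
  have h2 := integral_map (μ := ℙ) (φ := fun ω => fun j : Fin N => Y j ω)
    (measurable_pi_lambda _ fun j => hY _).aemeasurable
    (hF.aestronglyMeasurable)
  rw [hex σ] at h1
  exact h1.symm.trans h2

lemma exch_variance {N k : ℕ} (hk : 1 ≤ k) (hkN : k ≤ N) (Y : ℕ → Ω → E)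
    (hY : ∀ j, Measurable (Y j))
    (hex : ∀ σ : Equiv.Perm (Fin N), ℙ.map (fun ω => fun j : Fin N => Y (σ j) ω)
        = ℙ.map (fun ω => fun j : Fin N => Y j ω))
    (f : E → ℝ) (hf : Measurable f) (hf1 : ∀ x, |f x| ≤ 1) :
    ∫ ω, ((N : ℝ)⁻¹ * ∑ j ∈ Finset.range N, f (Y j ω) -
      (k : ℝ)⁻¹ * ∑ j ∈ Finset.range k, f (Y j ω)) ^ 2 ∂ℙ ≤ 4 / k := by
  have hk0 : (0 : ℝ) < k := by exact_mod_cast hk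
  have hN0 : (0 : ℝ) < N := by exact_mod_cast (hk.trans hkN)
  have hkN' : (k : ℝ) ≤ N := by exact_mod_cast hkN
  set w : Fin N → ℝ := fun j => (N : ℝ)⁻¹ - if (j : ℕ) < k then (k : ℝ)⁻¹ else 0 with hw
  have hsub : (Finset.range N).filter (· < k) = Finset.range k := by
    ext x; simp; omega
  have hD : ∀ ω, (N : ℝ)⁻¹ * ∑ j ∈ Finset.range N, f (Y j ω) -
      (k : ℝ)⁻¹ * ∑ j ∈ Finset.range k, f (Y j ω) = ∑ j : Fin N, w j * f (Y j ω) := by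
    intro ω
    rw [Fin.sum_univ_eq_sum_range
      (fun j => ((N : ℝ)⁻¹ - if j < k then (k : ℝ)⁻¹ else 0) * f (Y j ω)) N]
    simp_rw [sub_mul, ite_mul, zero_mul]
    rw [Finset.sum_sub_distrib, ← Finset.mul_sum, ← Finset.sum_filter, hsub, Finset.mul_sum]
    rw [Finset.mul_sum]
  have hw0 : ∑ j, w j = 0 := by
    rw [Fin.sum_univ_eq_sum_range (fun j => ((N : ℝ)⁻¹ - if j < k then (k : ℝ)⁻¹ else 0)) N,
      Finset.sum_sub_distrib, ← Finset.sum_filter, hsub]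
    simp [hk0.ne', hN0.ne']
  have hw2 : ∑ j, w j ^ 2 ≤ 2 / k := by
    have : ∀ j, w j ^ 2 ≤ (N : ℝ)⁻¹ ^ 2 + if (j : ℕ) < k then (k : ℝ)⁻¹ ^ 2 else 0 := by
      intro j
      have h1 : 0 < (N : ℝ)⁻¹ := by positivity
      have h2 : 0 < (k : ℝ)⁻¹ := by positivity
      simp only [hw]
      split_ifs
      · nlinarith [mul_pos h1 h2]
      · simp
    refine (Finset.sum_le_sum fun j _ => this j).trans ?_
    rw [Fin.sum_univ_eq_sum_range
      (fun j => ((N : ℝ)⁻¹ ^ 2 + if j < k then (k : ℝ)⁻¹ ^ 2 else 0)) N,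
      Finset.sum_add_distrib, ← Finset.sum_filter, hsub]
    simp only [Finset.sum_const, Finset.card_range, nsmul_eq_mul]
    have e1 : (N : ℝ) * (N : ℝ)⁻¹ ^ 2 = (N : ℝ)⁻¹ := by field_simp
    have e2 : (k : ℝ) * (k : ℝ)⁻¹ ^ 2 = (k : ℝ)⁻¹ := by field_simp
    rw [e1, e2]
    have : (N : ℝ)⁻¹ ≤ (k : ℝ)⁻¹ := inv_anti₀ hk0 hkN'
    rw [div_eq_mul_inv]; linarith
  have hfm : ∀ j, Measurable fun ω => f (Y j ω) := fun j => hf.comp (hY j)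
  have hint : ∀ i j : Fin N, Integrable (fun ω => f (Y i ω) * f (Y j ω)) ℙ := by
    intro i j
    refine Integrable.of_bound ((hfm i).mul (hfm j)).aestronglyMeasurable 1 (ae_of_all _ ?_)
    intro ω
    rw [norm_mul]
    exact mul_le_one₀ (hf1 _) (norm_nonneg _) (hf1 _)
  have habs : ∀ i j : Fin N, |∫ ω, f (Y i ω) * f (Y j ω) ∂ℙ| ≤ 1 := by
    intro i j
    have := norm_integral_le_of_norm_le_const (μ := ℙ) (f := fun ω => f (Y i ω) * f (Y j ω))
      (C := 1) (ae_of_all _ fun ω => by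
        rw [norm_mul]
        exact mul_le_one₀ (hf1 _) (norm_nonneg _) (hf1 _))
    simpa using this
  obtain ⟨b, hb1, hb⟩ : ∃ b : ℝ, |b| ≤ 1 ∧ ∀ i j : Fin N, i ≠ j →
      ∫ ω, f (Y i ω) * f (Y j ω) ∂ℙ = b := by
    by_cases h : ∃ i j : Fin N, i ≠ j
    · obtain ⟨k, l, hkl⟩ := h
      refine ⟨∫ ω, f (Y k ω) * f (Y l ω) ∂ℙ, habs k l, fun i j hij => ?_⟩
      obtain ⟨σ, rfl, rfl⟩ := exists_perm_pair i j k l hij hkl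
      exact exch_integral Y hY hex f hf σ k l
    · push Not at h
      exact ⟨0, by simp, fun i j hij => absurd (h i j) hij⟩
  have hpt : ∀ ω, (∑ j : Fin N, w j * f (Y j ω)) ^ 2 =
      ∑ i, ∑ j, w i * w j * (f (Y i ω) * f (Y j ω)) := by
    intro ω
    rw [sq, Finset.sum_mul_sum]
    refine Finset.sum_congr rfl fun i _ => Finset.sum_congr rfl fun j _ => by ring
  simp_rw [hD, hpt]
  rw [integral_finsetSum _ (fun i _ => integrable_finsetSum _ fun j _ => (hint i j).const_mul _)]
  simp_rw [integral_finsetSum _ (fun j _ => (hint _ j).const_mul _), integral_const_mul]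
  have hterm : ∀ i j : Fin N, w i * w j * ∫ ω, f (Y i ω) * f (Y j ω) ∂ℙ ≤
      w i * w j * b + if i = j then 2 * w i ^ 2 else 0 := by
    intro i j
    by_cases h : i = j
    · subst h
      have h1 := (abs_le.1 (habs i i)).2
      have h2 := (abs_le.1 hb1).1
      simp only [if_true]
      nlinarith [mul_self_nonneg (w i)]
    · rw [hb i j h]; simp [h]
  calc _ ≤ ∑ i, ∑ j, (w i * w j * b + if i = j then 2 * w i ^ 2 else 0) :=
        Finset.sum_le_sum fun i _ => Finset.sum_le_sum fun j _ => hterm i j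
    _ = 2 * ∑ i, w i ^ 2 := by
        simp_rw [Finset.sum_add_distrib]
        have : ∑ i, ∑ j, w i * w j * b = (∑ i, w i) * (∑ j, w j) * b := by
          rw [Finset.sum_mul_sum, Finset.sum_mul]
          simp_rw [Finset.sum_mul]
        rw [this, hw0, Finset.mul_sum]
        simp
    _ ≤ 2 * (2 / k) := by gcongr
    _ = 4 / k := by ring

lemma abs_le_sqrt_var (D : Ω → ℝ) (hD : Measurable D) (B : ℝ) (hB : ∀ ω, |D ω| ≤ B) (c : ℝ)
    (hc : 0 < c) : ∫ ω, |D ω| ∂ℙ ≤ c + (∫ ω, D ω ^ 2 ∂ℙ) / c := by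
  have hi : Integrable (fun ω => D ω ^ 2) ℙ := by
    refine Integrable.of_bound (hD.pow_const 2).aestronglyMeasurable (B ^ 2) (ae_of_all _ fun ω => ?_)
    rw [norm_pow]
    exact pow_le_pow_left₀ (norm_nonneg _) (hB ω) 2
  have hi1 : Integrable (fun ω => |D ω|) ℙ :=
    (Integrable.of_bound hD.aestronglyMeasurable B (ae_of_all _ hB)).abs
  calc ∫ ω, |D ω| ∂ℙ ≤ ∫ ω, (c + D ω ^ 2 / c) ∂ℙ := by
        refine integral_mono hi1 ((integrable_const c).add (hi.div_const c)) fun ω => ?_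
        have : |D ω| * c ≤ c * c + D ω ^ 2 := by
          rw [← sq_abs]; nlinarith [sq_nonneg (|D ω| - c), abs_nonneg (D ω)]
        calc |D ω| = |D ω| * c / c := by field_simp
          _ ≤ (c * c + D ω ^ 2) / c := by gcongr
          _ = c + D ω ^ 2 / c := by field_simp
    _ = _ := by
        rw [integral_add (integrable_const c) (hi.div_const c), integral_div]
        simp

lemma mean_abs_le (N : ℕ) (u : ℕ → ℝ) (hu : ∀ j, |u j| ≤ 1) :
    |(N : ℝ)⁻¹ * ∑ j ∈ Finset.range N, u j| ≤ 1 := by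
  rw [abs_mul, abs_of_nonneg (by positivity : (0 : ℝ) ≤ (N : ℝ)⁻¹)]
  have h1 : |∑ j ∈ Finset.range N, u j| ≤ N := by
    refine (Finset.abs_sum_le_sum_abs _ _).trans ?_
    refine (Finset.sum_le_sum fun j _ => hu j).trans ?_
    simp
  rcases N.eq_zero_or_pos with h | h
  · subst h; simp
  · rw [inv_mul_eq_div, div_le_one (by exact_mod_cast h)]
    exact h1

lemma exch_L1 [TopologicalSpace E] [BorelSpace E] (Y : ℕ → ℕ → Ω → E) (Yinf : ℕ → Ω → E)
    (hY : ∀ N j, Measurable (Y N j)) (hYinf : ∀ j, Measurable (Yinf j))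
    (hex : ∀ N, ∀ σ : Equiv.Perm (Fin N), ℙ.map (fun ω => fun j : Fin N => Y N (σ j) ω)
        = ℙ.map (fun ω => fun j : Fin N => Y N j ω))
    (hconv : ∀ j, ∀ᵐ ω ∂ℙ, Tendsto (fun N => Y N j ω) atTop (𝓝 (Yinf j ω)))
    (f : E → ℝ) (hf : Continuous f) (hf1 : ∀ x, |f x| ≤ 1) (g : Ω → ℝ)
    (hg : ∀ᵐ ω ∂ℙ, Tendsto (fun N : ℕ => (N : ℝ)⁻¹ * ∑ j ∈ Finset.range N, f (Yinf j ω)) atTop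
      (𝓝 (g ω))) :
    AEMeasurable g ℙ ∧
    Tendsto (fun N : ℕ => ∫⁻ ω, ENNReal.ofReal
      |(N : ℝ)⁻¹ * ∑ j ∈ Finset.range N, f (Y N j ω) - g ω| ∂ℙ) atTop (𝓝 0) := by
  set S : ℕ → ℕ → Ω → ℝ := fun k N ω => (k : ℝ)⁻¹ * ∑ j ∈ Finset.range k, f (Y N j ω) with hS
  set Si : ℕ → Ω → ℝ := fun k ω => (k : ℝ)⁻¹ * ∑ j ∈ Finset.range k, f (Yinf j ω) with hSi
  have hSm : ∀ k N, Measurable (S k N) := fun k N =>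
    (Finset.measurable_fun_sum _ fun j _ => hf.measurable.comp (hY N j)).const_mul _
  have hSim : ∀ k, Measurable (Si k) := fun k =>
    (Finset.measurable_fun_sum _ fun j _ => hf.measurable.comp (hYinf j)).const_mul _
  have hgm : AEMeasurable g ℙ := aemeasurable_of_tendsto_metrizable_ae atTop
    (fun k => (hSim k).aemeasurable) hg
  have hS1 : ∀ k N ω, |S k N ω| ≤ 1 := fun k N ω => mean_abs_le _ _ fun j => hf1 _
  have hSi1 : ∀ k ω, |Si k ω| ≤ 1 := fun k ω => mean_abs_le _ _ fun j => hf1 _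
  have hg1 : ∀ᵐ ω ∂ℙ, |g ω| ≤ 1 := by
    filter_upwards [hg] with ω hω
    exact le_of_tendsto hω.abs (Eventually.of_forall fun k => hSi1 k ω)
  have iS : ∀ k N, Integrable (S k N) ℙ := fun k N =>
    Integrable.of_bound (hSm k N).aestronglyMeasurable 1 (ae_of_all _ (hS1 k N))
  have iSi : ∀ k, Integrable (Si k) ℙ := fun k =>
    Integrable.of_bound (hSim k).aestronglyMeasurable 1 (ae_of_all _ (hSi1 k))
  have ig : Integrable g ℙ := Integrable.of_bound hgm.aestronglyMeasurable 1 hg1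
  refine ⟨hgm, ?_⟩
  -- third term
  have t3 : Tendsto (fun k => ∫ ω, |Si k ω - g ω| ∂ℙ) atTop (𝓝 0) := by
    have := tendsto_integral_of_dominated_convergence (μ := ℙ) (F := fun k ω => |Si k ω - g ω|)
      (f := fun _ => 0) (fun _ => 2) (fun k => ((iSi k).sub ig).abs.aestronglyMeasurable)
      (integrable_const _) (fun k => ?_) ?_
    · simpa using this
    · filter_upwards [hg1] with ω hω
      rw [Real.norm_eq_abs, abs_abs]
      exact (abs_sub _ _).trans (by linarith [hSi1 k ω])
    · filter_upwards [hg] with ω hω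
      have := (hω.sub_const (g ω)).abs
      simpa using this
  have t2 : ∀ k, Tendsto (fun N => ∫ ω, |S k N ω - Si k ω| ∂ℙ) atTop (𝓝 0) := by
    intro k
    have := tendsto_integral_of_dominated_convergence (μ := ℙ)
      (F := fun N ω => |S k N ω - Si k ω|)
      (f := fun _ => 0) (fun _ => 2) (fun N => ((iS k N).sub (iSi k)).abs.aestronglyMeasurable)
      (integrable_const _) (fun N => ae_of_all _ fun ω => ?_) ?_
    · simpa using this
    · rw [Real.norm_eq_abs, abs_abs]
      exact (abs_sub _ _).trans (by linarith [hSi1 k ω, hS1 k N ω])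
    · filter_upwards [ae_all_iff.2 hconv] with ω hω
      have h1 : Tendsto (fun N => S k N ω) atTop (𝓝 (Si k ω)) := by
        refine Tendsto.const_mul _ (tendsto_finsetSum _ fun j _ => ?_)
        exact (hf.tendsto _).comp (hω j)
      have := (h1.sub_const (Si k ω)).abs
      simpa using this
  have t1 : ∀ (c : ℝ), 0 < c → ∀ k N, 1 ≤ k → k ≤ N →
      ∫ ω, |S N N ω - S k N ω| ∂ℙ ≤ c + 4 / k / c := by
    intro c hc k N hk hkN
    refine (abs_le_sqrt_var _ ((hSm N N).sub (hSm k N)) 2 (fun ω => ?_) c hc).trans ?_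
    · exact (abs_sub _ _).trans (by linarith [hS1 N N ω, hS1 k N ω])
    · gcongr
      exact exch_variance hk hkN (Y N) (hY N) (hex N) f hf.measurable hf1
  have main : Tendsto (fun N => ∫ ω, |S N N ω - g ω| ∂ℙ) atTop (𝓝 0) := by
    rw [Metric.tendsto_atTop]
    intro δ hδ
    have hk4 : Tendsto (fun k : ℕ => (4 : ℝ) / k / (δ / 8)) atTop (𝓝 0) := by
      have := (tendsto_const_div_atTop_nhds_zero_nat (4 : ℝ)).div_const (δ / 8)
      simpa using this
    obtain ⟨k, hk1, hk2, hk3⟩ := ((eventually_ge_atTop 1).and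
      ((hk4.eventually (gt_mem_nhds (by positivity : 0 < δ / 8))).and
      (t3.eventually (gt_mem_nhds (by positivity : 0 < δ / 8))))).exists
    obtain ⟨N₀, hN₀⟩ := eventually_atTop.1
      ((t2 k).eventually (gt_mem_nhds (by positivity : 0 < δ / 8)))
    refine ⟨max N₀ k, fun N hN => ?_⟩
    have a1 := t1 (δ / 8) (by positivity) k N hk1 ((le_max_right _ _).trans hN)
    have a2 := hN₀ N ((le_max_left _ _).trans hN)
    have hle : ∫ ω, |S N N ω - g ω| ∂ℙ ≤ ∫ ω, |S N N ω - S k N ω| ∂ℙ +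
        ∫ ω, |S k N ω - Si k ω| ∂ℙ + ∫ ω, |Si k ω - g ω| ∂ℙ := by
      have i1 : Integrable (fun ω => |S N N ω - S k N ω|) ℙ := ((iS N N).sub (iS k N)).abs
      have i2 : Integrable (fun ω => |S k N ω - Si k ω|) ℙ := ((iS k N).sub (iSi k)).abs
      have i3 : Integrable (fun ω => |Si k ω - g ω|) ℙ := ((iSi k).sub ig).abs
      rw [← integral_add i1 i2, ← integral_add (by exact i1.add i2) i3]
      refine integral_mono ((iS N N).sub ig).abs ((i1.add i2).add i3) fun ω => ?_
      exact (abs_sub_le _ (Si k ω) _).trans (add_le_add_left (abs_sub_le _ (S k N ω) _) _)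
    rw [Real.dist_eq, sub_zero, abs_of_nonneg (integral_nonneg fun ω => abs_nonneg _)]
    linarith
  have heq : ∀ N, ∫⁻ ω, ENNReal.ofReal |S N N ω - g ω| ∂ℙ =
      ENNReal.ofReal (∫ ω, |S N N ω - g ω| ∂ℙ) := fun N =>
    (ofReal_integral_eq_lintegral_ofReal ((iS N N).sub ig).abs
      (ae_of_all _ fun ω => abs_nonneg _)).symm
  have := ENNReal.tendsto_ofReal main
  simp only [← heq, ENNReal.ofReal_zero] at this
  exact this

end Exch

section Emp

variable {E : Type*} [MeasurableSpace E]

lemma empirical_prob (N : ℕ) (hN : 1 ≤ N) (x : ℕ → E) : IsProbabilityMeasure (empirical N x) := by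
  constructor
  have : (N : ℝ≥0∞) ≠ 0 := by exact_mod_cast (by omega : N ≠ 0)
  simp [empirical, ENNReal.inv_mul_cancel this (ENNReal.natCast_ne_top N)]

lemma empirical_lintegral (N : ℕ) (x : ℕ → E) (f : E → ℝ≥0∞) (hf : Measurable f) :
    ∫⁻ y, f y ∂(empirical N x) = (N : ℝ≥0∞)⁻¹ * ∑ j ∈ Finset.range N, f (x j) := by
  simp [empirical, lintegral_finsetSum_measure, lintegral_dirac' _ hf]

lemma empirical_integral (N : ℕ) (x : ℕ → E) (f : E → ℝ) (hf : Measurable f) (hb : ∃ C, ∀ y, |f y| ≤ C) :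
    ∫ y, f y ∂(empirical N x) = (N : ℝ)⁻¹ * ∑ j ∈ Finset.range N, f (x j) := by
  obtain ⟨C, hC⟩ := hb
  rw [empirical, integral_smul_measure, integral_finsetSum_measure]
  · simp [integral_dirac' _ _ hf.stronglyMeasurable]
  · intro j _
    exact Integrable.of_bound hf.aestronglyMeasurable C (ae_of_all _ hC)

end Emp

/-- Lower semicontinuity of the second moment under weak convergence of empirical measures. -/
lemma second_moment_le {E : Type*} [NormedAddCommGroup E] [MeasurableSpace E] [BorelSpace E]
    (x : ℕ → E) (ν : Measure E) [IsProbabilityMeasure ν]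
    (h : ∀ f : E → ℝ, Continuous f → (∃ C, ∀ x, |f x| ≤ C) →
      Tendsto (fun N => ∫ y, f y ∂(empirical N x)) atTop (𝓝 (∫ y, f y ∂ν))) :
    ∫⁻ y, ‖y‖ₑ ^ 2 ∂ν ≤
      liminf (fun N : ℕ => (N : ℝ≥0∞)⁻¹ * ∑ j ∈ Finset.range N, ‖x j‖ₑ ^ 2) atTop := by
  set F : ℕ → E → ℝ := fun m y => min (‖y‖ ^ 2) m with hF
  have hFc : ∀ m, Continuous (F m) := fun m => by fun_prop
  have hF0 : ∀ m y, 0 ≤ F m y := fun m y => le_min (by positivity) (by positivity)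
  have hFb : ∀ m y, |F m y| ≤ m := fun m y => by
    rw [abs_of_nonneg (hF0 m y)]; exact min_le_right _ _
  have hq : ∀ y : E, ‖y‖ₑ ^ 2 = ENNReal.ofReal (‖y‖ ^ 2) := fun x => by
    rw [← ofReal_norm, ENNReal.ofReal_pow (norm_nonneg _)]
  have hsup : ∀ y : E, ‖y‖ₑ ^ 2 = ⨆ m, ENNReal.ofReal (F m y) := by
    intro y
    rw [hq]
    apply le_antisymm
    · obtain ⟨m, hm⟩ := exists_nat_ge (‖y‖ ^ 2)
      refine le_iSup_of_le m ?_
      simp [hF, min_eq_left hm]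
    · exact iSup_le fun m => ENNReal.ofReal_le_ofReal (min_le_left _ _)
  simp_rw [hsup]
  rw [lintegral_iSup (fun m => (hFc m).measurable.ennreal_ofReal)]
  · refine iSup_le fun m => ?_
    have hi : ∀ (μ : Measure E) [IsFiniteMeasure μ], Integrable (F m) μ := fun μ _ =>
      Integrable.of_bound (hFc m).measurable.aestronglyMeasurable m (ae_of_all _ (hFb m))
    rw [← ofReal_integral_eq_lintegral_ofReal (hi ν) (ae_of_all _ (hF0 m))]
    have ht := ENNReal.tendsto_ofReal (h (F m) (hFc m) ⟨m, hFb m⟩)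
    rw [← ht.liminf_eq]
    refine liminf_le_liminf ?_
    filter_upwards [eventually_ge_atTop 1] with N hN
    have := empirical_prob N hN x
    rw [ofReal_integral_eq_lintegral_ofReal (hi _) (ae_of_all _ (hF0 m)),
      empirical_lintegral _ _ _ (hFc m).measurable.ennreal_ofReal]
    gcongr with j _
    exact le_iSup (fun m => ENNReal.ofReal (F m (x j))) m
  · intro m m' hmm y
    exact ENNReal.ofReal_le_ofReal (min_le_min le_rfl (by exact_mod_cast hmm))

lemma mean_lintegral_le {Ω : Type*} [MeasurableSpace Ω] {ℙ : Measure Ω} (N : ℕ)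
    (u : ℕ → Ω → ℝ≥0∞) (hu : ∀ j, Measurable (u j)) (C : ℝ≥0∞)
    (hC : ∀ j < N, ∫⁻ ω, u j ω ∂ℙ ≤ C) :
    ∫⁻ ω, (N : ℝ≥0∞)⁻¹ * ∑ j ∈ Finset.range N, u j ω ∂ℙ ≤ C := by
  rw [lintegral_const_mul _ (Finset.measurable_fun_sum _ fun j _ => hu j),
    lintegral_finsetSum _ fun j _ => hu j]
  calc _ ≤ (N : ℝ≥0∞)⁻¹ * ∑ j ∈ Finset.range N, C := by
        gcongr with j hj
        exact hC j (Finset.mem_range.1 hj)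
    _ = ((N : ℝ≥0∞)⁻¹ * N) * C := by simp [mul_assoc]
    _ ≤ 1 * C := by gcongr; exact ENNReal.inv_mul_le_one _
    _ = C := one_mul _

/-- convergence in mean `p`-Wasserstein distance of the empirical
measures `Σ_t^N = (1/N)Σ_j δ_{X_t^{(N),j}}` of an exchangeable particle system to the
(random) de Finetti directing measure `ν_t` of the limit system, given almost sure
convergence `X^{(N),j} → X^{(∞),j}` in `C⁰([0,T], ℝⁿ)`, uniform second-moment bounds,
and the almost sure weak convergence `Σ̃_t^N ⇀ ν_t` of the limit empirical measures. -/
theorem statement19 {n : ℕ} (T : ℝ) (hT : 0 < T)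
    {Ω : Type*} [MeasurableSpace Ω] (ℙ : Measure Ω) [IsProbabilityMeasure ℙ]
    (X : ℕ → ℕ → ℝ → Ω → EuclideanSpace ℝ (Fin n))      -- `X N j t ω`, for `j < N`
    (Xinf : ℕ → ℝ → Ω → EuclideanSpace ℝ (Fin n))       -- `X ∞ j t ω`
    (hXmeas : ∀ N j t, Measurable fun ω => X N j t ω)
    (hXinfmeas : ∀ j t, Measurable fun ω => Xinf j t ω)
    -- exchangeability of the `N`-particle system (at every fixed time)
    (hexch : ∀ N : ℕ, ∀ σ : Equiv.Perm (Fin N), ∀ t ∈ Icc (0 : ℝ) T,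
      ℙ.map (fun ω => fun j : Fin N => X N (σ j) t ω)
        = ℙ.map (fun ω => fun j : Fin N => X N j t ω))
    -- almost sure convergence of each particle, uniformly on `[0,T]`
    (hconv : ∀ j : ℕ, ∀ᵐ ω ∂ℙ,
      TendstoUniformlyOn (fun N s => X N j s ω) (fun s => Xinf j s ω) atTop
        (Icc (0 : ℝ) T))
    -- uniform second-moment bounds
    (hmom : ∃ C : ℝ≥0∞, C ≠ ⊤ ∧ ∀ t ∈ Icc (0 : ℝ) T,
      (∀ N j, j < N → ∫⁻ ω, ‖X N j t ω‖₊ ^ 2 ∂ℙ ≤ C) ∧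
      (∀ j, ∫⁻ ω, ‖Xinf j t ω‖₊ ^ 2 ∂ℙ ≤ C))
    -- de Finetti directing (random) measure of the limit system
    (ν : ℝ → Ω → Measure (EuclideanSpace ℝ (Fin n)))
    (hνprob : ∀ t ∈ Icc (0 : ℝ) T, ∀ᵐ ω ∂ℙ, IsProbabilityMeasure (ν t ω))
    -- almost sure weak convergence `Σ̃_t^N ⇀ ν_t` (de Finetti's theorem)
    (hdeF : ∀ t ∈ Icc (0 : ℝ) T, ∀ᵐ ω ∂ℙ,
      ∀ f : EuclideanSpace ℝ (Fin n) → ℝ, Continuous f → (∃ C, ∀ x, |f x| ≤ C) →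
      Tendsto (fun N => ∫ x, f x ∂(empirical N (fun j => Xinf j t ω))) atTop
        (nhds (∫ x, f x ∂(ν t ω)))) :
    ∀ t ∈ Icc (0 : ℝ) T, ∀ p : ℝ, 1 ≤ p → p < 2 →
      Tendsto (fun N =>
          ∫ ω, (WppE p (empirical N (fun j => X N j t ω)) (ν t ω)).toReal ∂ℙ)
        atTop (nhds 0) := by
  intro t ht p hp hp2
  obtain ⟨C, hCtop, hCm⟩ := hmom
  obtain ⟨hC1, hC2⟩ := hCm t ht
  replace hC1 : ∀ N j, j < N → ∫⁻ ω, ‖X N j t ω‖ₑ ^ 2 ∂ℙ ≤ C := hC1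
  replace hC2 : ∀ j, ∫⁻ ω, ‖Xinf j t ω‖ₑ ^ 2 ∂ℙ ≤ C := hC2
  have hqX : ∀ N j, Measurable fun ω => ‖X N j t ω‖ₑ ^ 2 := fun N j =>
    (hXmeas N j t).enorm.pow_const 2
  have hqXi : ∀ j, Measurable fun ω => ‖Xinf j t ω‖ₑ ^ 2 := fun j =>
    (hXinfmeas j t).enorm.pow_const 2
  have hconv' : ∀ j, ∀ᵐ ω ∂ℙ, Tendsto (fun N => X N j t ω) atTop (𝓝 (Xinf j t ω)) := by
    intro j
    filter_upwards [hconv j] with ω hω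
    exact hω.tendsto_at ht
  -- second moments of the limit measure
  set L : Ω → ℝ≥0∞ := fun ω =>
    liminf (fun N : ℕ => (N : ℝ≥0∞)⁻¹ * ∑ j ∈ Finset.range N, ‖Xinf j t ω‖ₑ ^ 2) atTop with hL
  have hmm : ∀ N : ℕ, Measurable fun ω =>
      (N : ℝ≥0∞)⁻¹ * ∑ j ∈ Finset.range N, ‖Xinf j t ω‖ₑ ^ 2 := fun N =>
    (Finset.measurable_fun_sum _ fun j _ => hqXi j).const_mul _
  have hLm : Measurable L := Measurable.liminf hmm
  have hLC : ∫⁻ ω, L ω ∂ℙ ≤ C := by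
    refine (lintegral_liminf_le hmm).trans ?_
    refine liminf_le_of_le (by isBoundedDefault) fun b hb => ?_
    obtain ⟨N, hN⟩ := hb.exists
    exact hN.trans (mean_lintegral_le N _ hqXi C fun j _ => hC2 j)
  have hνL : ∀ᵐ ω ∂ℙ, ∫⁻ y, ‖y‖ₑ ^ 2 ∂(ν t ω) ≤ L ω := by
    filter_upwards [hνprob t ht, hdeF t ht] with ω h1 h2
    exact second_moment_le (fun j => Xinf j t ω) (ν t ω) h2
  have key : Tendsto (fun N => ∫⁻ ω, WppE p (empirical N (fun j => X N j t ω)) (ν t ω) ∂ℙ)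
      atTop (𝓝 0) := by
    rw [ENNReal.tendsto_nhds_zero]
    intro δ hδ
    have hδ3 : (0 : ℝ≥0∞) < δ / 3 := ENNReal.div_pos hδ.ne' (by simp)
    -- choice of the mesh size
    obtain ⟨ε, hε, hεδ⟩ : ∃ ε : ℝ, 0 < ε ∧ 2 * ENNReal.ofReal ((2 * ε) ^ p) ≤ δ / 3 := by
      have h1 : Tendsto (fun ε : ℝ => 2 * ENNReal.ofReal ((2 * ε) ^ p)) (𝓝[>] 0) (𝓝 0) := by
        have hc : Continuous fun ε : ℝ => ENNReal.ofReal ((2 * ε) ^ p) :=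
          ENNReal.continuous_ofReal.comp
            ((continuous_const.mul continuous_id).rpow_const fun _ => Or.inr (by linarith))
        have h2 := ENNReal.Tendsto.const_mul (a := 2) (hc.tendsto 0) (Or.inr (by simp))
        have h3 : 2 * ENNReal.ofReal ((2 * (0 : ℝ)) ^ p) = 0 := by
          rw [mul_zero, Real.zero_rpow (by linarith)]; simp
        rw [h3] at h2
        exact h2.mono_left nhdsWithin_le_nhds
      obtain ⟨ε, h2, h3⟩ := ((ENNReal.tendsto_nhds_zero.1 h1 _ hδ3).and
        self_mem_nhdsWithin).exists
      exact ⟨ε, h3, h2⟩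
    -- choice of the truncation radius
    obtain ⟨R, hR, hRδ⟩ : ∃ R : ℝ, 0 < R ∧
        ENNReal.ofReal (12 * R ^ (p - 2)) * (C + C) ≤ δ / 3 := by
      have h1 : Tendsto (fun R : ℝ => ENNReal.ofReal (12 * R ^ (p - 2)) * (C + C)) atTop
          (𝓝 0) := by
        have h2 := (tendsto_rpow_neg_atTop (by linarith : 0 < 2 - p)).const_mul (12 : ℝ)
        have h3 := ENNReal.Tendsto.mul_const (b := C + C) (ENNReal.tendsto_ofReal h2)
          (Or.inr (by simp [hCtop]))
        simpa using h3
      obtain ⟨R, h2, h3⟩ := ((ENNReal.tendsto_nhds_zero.1 h1 _ hδ3).and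
        (eventually_gt_atTop 0)).exists
      exact ⟨R, h3, h2⟩
    obtain ⟨ι, _, φ, hφc, hφ1, hbound⟩ := WppE_bound (n := n) p ε R hp hp2 hε hR
    set G : ι → ℕ → Ω → ℝ≥0∞ := fun i N ω => ENNReal.ofReal
      |(N : ℝ)⁻¹ * ∑ j ∈ Finset.range N, φ i (X N j t ω) - ∫ x, φ i x ∂(ν t ω)| with hG
    have hlim : ∀ i, AEMeasurable (fun ω => ∫ x, φ i x ∂(ν t ω)) ℙ ∧
        Tendsto (fun N => ∫⁻ ω, G i N ω ∂ℙ) atTop (𝓝 0) := by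
      intro i
      refine exch_L1 (fun N j ω => X N j t ω) (fun j ω => Xinf j t ω) (fun N j => hXmeas N j t)
        (fun j => hXinfmeas j t) (fun N σ => hexch N σ t ht) hconv' (φ i) (hφc i) (hφ1 i) _ ?_
      filter_upwards [hdeF t ht] with ω hω
      have := hω (φ i) (hφc i) ⟨1, hφ1 i⟩
      simpa only [empirical_integral _ _ (φ i) (hφc i).measurable ⟨1, hφ1 i⟩] using this
    have hGm : ∀ i N, AEMeasurable (G i N) ℙ := by
      intro i N
      have h1 : Measurable fun ω => (N : ℝ)⁻¹ * ∑ j ∈ Finset.range N, φ i (X N j t ω) :=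
        (Finset.measurable_fun_sum _ fun j _ =>
          (hφc i).measurable.comp (hXmeas N j t)).const_mul _
      exact (continuous_abs.measurable.comp_aemeasurable
        (h1.aemeasurable.sub (hlim i).1)).ennreal_ofReal
    have hsum : Tendsto (fun N => 2 * ENNReal.ofReal (4 * R ^ p) * ∑ i, ∫⁻ ω, G i N ω ∂ℙ) atTop
        (𝓝 0) := by
      have h1 := ENNReal.Tendsto.const_mul (a := 2 * ENNReal.ofReal (4 * R ^ p))
        (tendsto_finsetSum Finset.univ fun i _ => (hlim i).2)
        (Or.inr (ENNReal.mul_ne_top (by simp) ENNReal.ofReal_ne_top))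
      simpa using h1
    filter_upwards [eventually_ge_atTop 1, ENNReal.tendsto_nhds_zero.1 hsum _ hδ3] with N hN hN2
    set M : Ω → ℝ≥0∞ := fun ω => (N : ℝ≥0∞)⁻¹ * ∑ j ∈ Finset.range N, ‖X N j t ω‖ₑ ^ 2 with hM
    have hMm : Measurable M := (Finset.measurable_fun_sum _ fun j _ => hqX N j).const_mul _
    have hMC : ∫⁻ ω, M ω ∂ℙ ≤ C := mean_lintegral_le N _ (hqX N) C fun j hj => hC1 N j hj
    have hML : Measurable fun ω => M ω + L ω := hMm.add hLm
    calc ∫⁻ ω, WppE p (empirical N (fun j => X N j t ω)) (ν t ω) ∂ℙ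
        ≤ ∫⁻ ω, (2 * ENNReal.ofReal ((2 * ε) ^ p) + 2 * ENNReal.ofReal (4 * R ^ p) *
          ∑ i, G i N ω + ENNReal.ofReal (12 * R ^ (p - 2)) * (M ω + L ω)) ∂ℙ := by
          refine lintegral_mono_ae ?_
          filter_upwards [hνprob t ht, hνL] with ω h1 h2
          refine (hbound _ _ (empirical_prob N hN _) h1).trans ?_
          rw [empirical_lintegral _ _ _ (by fun_prop)]
          simp_rw [empirical_integral _ _ (φ _) (hφc _).measurable ⟨1, hφ1 _⟩]
          gcongr
      _ = 2 * ENNReal.ofReal ((2 * ε) ^ p) + 2 * ENNReal.ofReal (4 * R ^ p) *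
          ∑ i, ∫⁻ ω, G i N ω ∂ℙ + ENNReal.ofReal (12 * R ^ (p - 2)) *
            (∫⁻ ω, M ω ∂ℙ + ∫⁻ ω, L ω ∂ℙ) := by
          rw [lintegral_add_right _ (hML.const_mul _), lintegral_add_left measurable_const,
            lintegral_const_mul _ hML, lintegral_add_left hMm,
            lintegral_const_mul'' _ (Finset.aemeasurable_fun_sum _ fun i _ => hGm i N),
            lintegral_finsetSum' _ fun i _ => hGm i N]
          simp
      _ ≤ δ / 3 + δ / 3 + δ / 3 := by
          refine add_le_add (add_le_add hεδ hN2) (le_trans ?_ hRδ)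
          gcongr
      _ = δ := ENNReal.add_thirds δ
  have key2 := (ENNReal.tendsto_toReal ENNReal.zero_ne_top).comp key
  rw [ENNReal.toReal_zero] at key2
  refine squeeze_zero' (Eventually.of_forall fun N => integral_nonneg fun ω => ENNReal.toReal_nonneg)
    ?_ key2
  filter_upwards [key.eventually_lt_const ENNReal.zero_lt_top] with N hN
  refine (Real.le_norm_self _).trans ((norm_integral_le_lintegral_norm _).trans ?_)
  refine ENNReal.toReal_mono hN.ne (lintegral_mono fun ω => ?_)
  rw [Real.norm_of_nonneg ENNReal.toReal_nonneg]
  exact ENNReal.ofReal_toReal_le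
end
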